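/- arXiv:1906.06259 — 5 statements merged into one kernel-verified Lean document; each statement's English description precedes it below -/
import Mathlib

section
/- Let I be a square-free monomial ideal of R = k[x_1,...,x_n] (k a field) with associated Stanley–Reisner simplicial complex Δ = Δ(I). Suppose reg(I) ≤ r and pd(I) ≤ n - r + 1. If r is even and the reduced Euler characteristic satisfies χ̃(Δ) > 0, then reg(I) = r. -/
/-- The faces of cardinality `m` of a simplicial complex, given as a finite
family of finite subsets of `Fin n`. -/
def cfaces {n : ℕ} (Δ : Finset (Finset (Fin n))) (m : ℕ) : Finset (Finset (Fin n)) :=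
  Δ.filter (fun F => F.card = m)

/-- The coefficient of the face `G` in the simplicial boundary of the face `F`
(with respect to the linear order on the vertices `Fin n`). -/
noncomputable def bcoeff (K : Type*) [Field K] {n : ℕ} (F G : Finset (Fin n)) : K :=
  ∑ v ∈ F, if F.erase v = G then (-1 : K) ^ (F.filter (fun w => w < v)).card else 0

/-- The simplicial boundary map from chains spanned by faces of cardinality `m+1`
to chains spanned by faces of cardinality `m` (so the augmentation map
corresponds to `m = 0`). -/
noncomputable def boundaryMap (K : Type*) [Field K] {n : ℕ}
    (Δ : Finset (Finset (Fin n))) (m : ℕ) :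
    ({F // F ∈ cfaces Δ (m + 1)} → K) →ₗ[K] ({G // G ∈ cfaces Δ m} → K) :=
  LinearMap.pi fun G => ∑ F : {F // F ∈ cfaces Δ (m + 1)}, bcoeff K F.1 G.1 • LinearMap.proj F

/-- The dimension over `K` of the `i`-th reduced simplicial homology of the
simplicial complex `Δ` (using the augmented chain complex, so that
`i = -1` is allowed). -/
noncomputable def reducedHomologyRank (K : Type*) [Field K] {n : ℕ}
    (Δ : Finset (Finset (Fin n))) (i : ℤ) : ℕ :=
  if i = -1 then
    Module.finrank K (({F // F ∈ cfaces Δ 0} → K) ⧸ LinearMap.range (boundaryMap K Δ 0))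
  else if 0 ≤ i then
    Module.finrank K
      (↥(LinearMap.ker (boundaryMap K Δ i.toNat)) ⧸
        Submodule.comap (LinearMap.ker (boundaryMap K Δ i.toNat)).subtype
          (LinearMap.range (boundaryMap K Δ (i.toNat + 1))))
  else 0

/-- The graded Betti numbers `β_{i,j}` of the Stanley–Reisner ideal of the
simplicial complex `Δ` over the field `K`, defined via Hochster's formula:
`β_{i,j} = ∑_{|W| = j} dim_K H̃_{j-i-2}(Δ_W; K)`. -/
noncomputable def bettiNumber (K : Type*) [Field K] {n : ℕ}
    (Δ : Finset (Finset (Fin n))) (i j : ℕ) : ℕ :=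
  ∑ W ∈ Finset.powersetCard j (Finset.univ : Finset (Fin n)),
    reducedHomologyRank K (Δ.filter (fun F => F ⊆ W)) ((j : ℤ) - (i : ℤ) - 2)

/-- The Castelnuovo–Mumford regularity `reg(I) = max { j - i | β_{i,j}(I) ≠ 0 }`
of the Stanley–Reisner ideal of `Δ` over `K`. -/
noncomputable def regSR (K : Type*) [Field K] {n : ℕ} (Δ : Finset (Finset (Fin n))) : ℕ :=
  sSup {d : ℕ | ∃ i j : ℕ, bettiNumber K Δ i j ≠ 0 ∧ (j : ℤ) - (i : ℤ) = d}

/-- The projective dimension `pd(I) = max { i | β_{i,j}(I) ≠ 0 for some j }`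
of the Stanley–Reisner ideal of `Δ` over `K`. -/
noncomputable def pdSR (K : Type*) [Field K] {n : ℕ} (Δ : Finset (Finset (Fin n))) : ℕ :=
  sSup {i : ℕ | ∃ j : ℕ, bettiNumber K Δ i j ≠ 0}

/-- The reduced Euler characteristic `χ̃(Δ) = ∑_{F ∈ Δ} (-1)^{|F| - 1}`
of a simplicial complex `Δ` (the alternating sum of the `f`-vector). -/
def eulerCharSR {n : ℕ} (Δ : Finset (Finset (Fin n))) : ℤ :=
  ∑ F ∈ Δ, (-1 : ℤ) ^ (F.card + 1)

/-- The composite of two simplicial face operators has vanishing matrix entries. -/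
theorem sum_sum_erase_erase_eq_zero (K : Type*) [Field K] {n : ℕ} (F H : Finset (Fin n)) :
    ∑ v ∈ F, (-1 : K) ^ (F.filter (fun w => w < v)).card * bcoeff K (F.erase v) H = 0 := by
  simp only [bcoeff, Finset.mul_sum]
  rw [Finset.sum_sigma']
  refine Finset.sum_involution (fun p _ => ⟨p.2, p.1⟩) ?_ ?_ ?_ ?_
  · rintro ⟨v, w⟩ hp
    simp only [Finset.mem_sigma, Finset.mem_erase] at hp
    obtain ⟨hv, hwv, hw⟩ := hp
    dsimp only
    rw [Finset.erase_right_comm (a := w) (b := v)]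
    split_ifs with hH
    · have key : ∀ a b : Fin n, a ∈ F → a < b →
          ((F.filter (fun x => x < b)).card = ((F.erase a).filter (fun x => x < b)).card + 1) ∧
          ((F.erase b).filter (fun x => x < a)).card = (F.filter (fun x => x < a)).card := by
        intro a b ha hab
        rw [Finset.filter_erase, Finset.filter_erase,
          Finset.card_erase_add_one (Finset.mem_filter.2 ⟨ha, hab⟩),
          Finset.erase_eq_of_notMem (a := b)]
        · exact ⟨rfl, rfl⟩
        · simp [hab.le]
      rcases lt_or_gt_of_ne hwv with h | h
      · rw [(key w v hw h).1, (key w v hw h).2]; ring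
      · rw [(key v w hv h).1, (key v w hv h).2]; ring
    · simp
  · rintro ⟨v, w⟩ hp _ heq
    simp only [Finset.mem_sigma, Finset.mem_erase] at hp
    simp only [Sigma.mk.injEq] at heq
    exact hp.2.1 heq.1
  · rintro ⟨v, w⟩ hp
    simp only [Finset.mem_sigma, Finset.mem_erase] at hp ⊢
    exact ⟨hp.2.2, hp.2.1.symm, hp.1⟩
  · rintro ⟨v, w⟩ _
    rfl

theorem sum_cfaces_bcoeff_mul_bcoeff (K : Type*) [Field K] {n : ℕ} {Δ : Finset (Finset (Fin n))}
    (hΔ : IsLowerSet (Δ : Set (Finset (Fin n)))) {m : ℕ} {F : Finset (Fin n)}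
    (hF : F ∈ cfaces Δ (m + 1)) (H : Finset (Fin n)) :
    ∑ G ∈ cfaces Δ m, bcoeff K F G * bcoeff K G H = 0 := by
  obtain ⟨hFΔ, hFc⟩ := Finset.mem_filter.1 hF
  rw [← sum_sum_erase_erase_eq_zero K F H]
  simp only [bcoeff.eq_1 K F, Finset.sum_mul]
  rw [Finset.sum_comm]
  refine Finset.sum_congr rfl fun v hv => ?_
  rw [Finset.sum_eq_single_of_mem (F.erase v)]
  · rw [if_pos rfl]
  · refine Finset.mem_filter.2 ⟨hΔ (Finset.erase_subset v F) hFΔ, ?_⟩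
    rw [Finset.card_erase_of_mem hv, hFc, Nat.add_sub_cancel]
  · intro G _ hG
    rw [if_neg (Ne.symm hG), zero_mul]

theorem boundaryMap_apply (K : Type*) [Field K] {n : ℕ} (Δ : Finset (Finset (Fin n))) (m : ℕ)
    (x : {F // F ∈ cfaces Δ (m + 1)} → K) (G : {G // G ∈ cfaces Δ m}) :
    boundaryMap K Δ m x G = ∑ F : {F // F ∈ cfaces Δ (m + 1)}, bcoeff K F.1 G.1 * x F := by
  simp [boundaryMap]

theorem boundaryMap_boundaryMap (K : Type*) [Field K] {n : ℕ} {Δ : Finset (Finset (Fin n))}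
    (hΔ : IsLowerSet (Δ : Set (Finset (Fin n)))) (m : ℕ)
    (x : {F // F ∈ cfaces Δ (m + 1 + 1)} → K) :
    boundaryMap K Δ m (boundaryMap K Δ (m + 1) x) = 0 := by
  ext H
  simp only [boundaryMap_apply, Finset.mul_sum, Pi.zero_apply]
  rw [Finset.sum_comm]
  refine Finset.sum_eq_zero fun F _ => ?_
  calc ∑ G : {G // G ∈ cfaces Δ (m + 1)}, bcoeff K G.1 H.1 * (bcoeff K F.1 G.1 * x F)
      = (∑ G : {G // G ∈ cfaces Δ (m + 1)}, bcoeff K F.1 G.1 * bcoeff K G.1 H.1) * x F := by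
        rw [Finset.sum_mul]
        exact Finset.sum_congr rfl fun G _ => by ring
    _ = 0 := by
        rw [Finset.sum_coe_sort (cfaces Δ (m + 1))
          (fun G => bcoeff K F.1 G * bcoeff K G H.1),
          sum_cfaces_bcoeff_mul_bcoeff K hΔ F.2, zero_mul]

/-- The rank of the boundary map defined on chains spanned by faces of cardinality `m`. -/
noncomputable def boundaryRank (K : Type*) [Field K] {n : ℕ} (Δ : Finset (Finset (Fin n))) :
    ℕ → ℕ
  | 0 => 0
  | m + 1 => Module.finrank K (LinearMap.range (boundaryMap K Δ m))

theorem reducedHomologyRank_add_boundaryRank (K : Type*) [Field K] {n : ℕ}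
    {Δ : Finset (Finset (Fin n))} (hΔ : IsLowerSet (Δ : Set (Finset (Fin n)))) (m : ℕ) :
    reducedHomologyRank K Δ ((m : ℤ) - 1) + boundaryRank K Δ m + boundaryRank K Δ (m + 1)
      = (cfaces Δ m).card := by
  cases m with
  | zero =>
    simpa [reducedHomologyRank, boundaryRank] using
      Submodule.finrank_quotient_add_finrank (LinearMap.range (boundaryMap K Δ 0))
  | succ m =>
    have hle : LinearMap.range (boundaryMap K Δ (m + 1)) ≤ LinearMap.ker (boundaryMap K Δ m) := by
      rintro _ ⟨x, rfl⟩
      exact boundaryMap_boundaryMap K hΔ m x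
    have hm : ((m + 1 : ℕ) : ℤ) - 1 = m := by push_cast; ring
    have hquot := Submodule.finrank_quotient_add_finrank
      (Submodule.comap (LinearMap.ker (boundaryMap K Δ m)).subtype
          (LinearMap.range (boundaryMap K Δ (m + 1))))
    rw [(Submodule.comapSubtypeEquivOfLe hle).finrank_eq] at hquot
    have hrank := LinearMap.finrank_range_add_finrank_ker (boundaryMap K Δ m)
    rw [Module.finrank_fintype_fun_eq_card, Fintype.card_coe] at hrank
    rw [hm, reducedHomologyRank, if_neg (by omega), if_pos (by omega)]
    simp only [Int.toNat_natCast, boundaryRank]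
    omega

theorem boundaryRank_le_card_cfaces (K : Type*) [Field K] {n : ℕ} {Δ : Finset (Finset (Fin n))}
    (hΔ : IsLowerSet (Δ : Set (Finset (Fin n)))) (m : ℕ) :
    boundaryRank K Δ m ≤ (cfaces Δ m).card := by
  have := reducedHomologyRank_add_boundaryRank K hΔ m
  omega

/-- The Euler–Poincaré formula. -/
theorem eulerCharSR_eq_sum_reducedHomologyRank (K : Type*) [Field K] {n : ℕ}
    {Δ : Finset (Finset (Fin n))} (hΔ : IsLowerSet (Δ : Set (Finset (Fin n)))) :
    eulerCharSR Δ =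
      ∑ m ∈ Finset.range (n + 1), (-1 : ℤ) ^ (m + 1) * reducedHomologyRank K Δ ((m : ℤ) - 1) := by
  have hcount : eulerCharSR Δ
      = ∑ m ∈ Finset.range (n + 1), (-1 : ℤ) ^ (m + 1) * (cfaces Δ m).card := by
    rw [eulerCharSR, ← Finset.sum_fiberwise_of_maps_to (g := Finset.card)
      (t := Finset.range (n + 1))
      (fun F _ => Finset.mem_range_succ_iff.2 (by simpa using F.card_le_univ))]
    refine Finset.sum_congr rfl fun m _ => ?_
    rw [Finset.sum_congr rfl (g := fun _ => (-1 : ℤ) ^ (m + 1))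
      (fun F hF => by rw [(Finset.mem_filter.1 hF).2]), Finset.sum_const, cfaces, nsmul_eq_mul,
      mul_comm]
  have htel : ∀ N : ℕ, ∑ m ∈ Finset.range N, (-1 : ℤ) ^ (m + 1) * (cfaces Δ m).card
      = ∑ m ∈ Finset.range N, (-1 : ℤ) ^ (m + 1) * reducedHomologyRank K Δ ((m : ℤ) - 1)
        + (-1) ^ N * boundaryRank K Δ N := by
    intro N
    induction N with
    | zero => simp [boundaryRank]
    | succ N ih =>
      rw [Finset.sum_range_succ, Finset.sum_range_succ, ih,
        ← reducedHomologyRank_add_boundaryRank K hΔ N]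
      push_cast
      ring
  have hempty : cfaces Δ (n + 1) = ∅ := by
    refine Finset.filter_eq_empty_iff.2 fun F _ hF => ?_
    have := F.card_le_univ
    rw [Fintype.card_fin] at this
    omega
  have hzero := boundaryRank_le_card_cfaces K hΔ (n + 1)
  rw [hempty, Finset.card_empty, Nat.le_zero] at hzero
  rw [hcount, htel, hzero]
  simp

theorem eulerCharSR_univ_nonpos (n : ℕ) :
    eulerCharSR (Finset.univ : Finset (Finset (Fin n))) ≤ 0 := by
  have h := Finset.sum_powerset_neg_one_pow_card (x := (Finset.univ : Finset (Fin n)))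
  rw [Finset.powerset_univ] at h
  simp only [eulerCharSR, pow_succ, ← Finset.sum_mul, h]
  split_ifs <;> norm_num

theorem bettiNumber_ne_zero_bounds {K : Type*} [Field K] {n : ℕ} {Δ : Finset (Finset (Fin n))}
    {i j : ℕ} (h : bettiNumber K Δ i j ≠ 0) : i ≤ n ∧ j ≤ n := by
  obtain ⟨W, hW, hne⟩ := Finset.exists_ne_zero_of_sum_ne_zero h
  have hj : j ≤ n := by
    rw [← (Finset.mem_powersetCard.1 hW).2]
    simpa using W.card_le_univ
  refine ⟨?_, hj⟩
  by_contra hi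
  refine hne ?_
  rw [reducedHomologyRank, if_neg (by omega), if_neg (by omega)]

theorem le_pdSR {K : Type*} [Field K] {n : ℕ} {Δ : Finset (Finset (Fin n))}
    {i j : ℕ} (h : bettiNumber K Δ i j ≠ 0) : i ≤ pdSR K Δ :=
  le_csSup ⟨n, by rintro _ ⟨_, h'⟩; exact (bettiNumber_ne_zero_bounds h').1⟩ ⟨j, h⟩

theorem le_regSR {K : Type*} [Field K] {n : ℕ} {Δ : Finset (Finset (Fin n))}
    {i j d : ℕ} (h : bettiNumber K Δ i j ≠ 0) (hd : (j : ℤ) - i = d) : d ≤ regSR K Δ := by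
  refine le_csSup ⟨n, ?_⟩ ⟨i, j, h, hd⟩
  rintro e ⟨i', j', h', he⟩
  have := (bettiNumber_ne_zero_bounds h').2
  omega

theorem bettiNumber_card (K : Type*) [Field K] {n : ℕ} (Δ : Finset (Finset (Fin n))) (i : ℕ) :
    bettiNumber K Δ i n = reducedHomologyRank K Δ ((n : ℤ) - i - 2) := by
  have h : Finset.powersetCard n (Finset.univ : Finset (Fin n)) = {Finset.univ} := by
    simpa using Finset.powersetCard_self (Finset.univ : Finset (Fin n))
  simp [bettiNumber, h]

/-- **Theorem (new regularity result, part (i)(a)).**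
Let `I` be a square-free monomial ideal of `R = K[x_1, …, x_n]` with associated
Stanley–Reisner simplicial complex `Δ = Δ(I)`.  Suppose `reg(I) ≤ r` and
`pd(I) ≤ n - r + 1`.  If `r` is even and `χ̃(Δ) > 0`, then `reg(I) = r`. -/
theorem regularity_of_squarefree_monomial_ideal_even_case
    (K : Type*) [Field K] (n r : ℕ)
    (I : Ideal (MvPolynomial (Fin n) K))
    (hsq : ∃ S : Set (Finset (Fin n)),
      I = Ideal.span ((fun F : Finset (Fin n) => ∏ v ∈ F, MvPolynomial.X v) '' S))
    (Δ : Finset (Finset (Fin n)))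
    (hΔ : ∀ F : Finset (Fin n),
      F ∈ Δ ↔ (∏ v ∈ F, MvPolynomial.X v : MvPolynomial (Fin n) K) ∉ I)
    (hreg : regSR K Δ ≤ r)
    (hpd : (pdSR K Δ : ℤ) ≤ (n : ℤ) - (r : ℤ) + 1)
    (hr : Even r)
    (hχ : 0 < eulerCharSR Δ) :
    regSR K Δ = r := by
  have hlow : IsLowerSet (Δ : Set (Finset (Fin n))) := by
    intro F G hGF hF
    rw [Finset.mem_coe, hΔ] at hF ⊢
    exact fun hG => hF (I.mem_of_dvd (Finset.prod_dvd_prod_of_subset _ _ _ hGF) hG)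
  have huniv : Finset.univ ∉ Δ := by
    intro h
    have hall : Δ = Finset.univ :=
      Finset.eq_univ_iff_forall.2 fun F => hlow (Finset.subset_univ F) h
    rw [hall] at hχ
    exact (eulerCharSR_univ_nonpos n).not_gt hχ
  rw [eulerCharSR_eq_sum_reducedHomologyRank K hlow] at hχ
  obtain ⟨m, hm, hpos⟩ := Finset.exists_lt_of_sum_lt
    (s := Finset.range (n + 1)) (f := fun _ => (0 : ℤ)) (by simpa using hχ)
  have hodd : Even (m + 1) := by
    by_contra hodd
    rw [(Nat.not_even_iff_odd.1 hodd).neg_one_pow] at hpos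
    omega
  have hne : reducedHomologyRank K Δ ((m : ℤ) - 1) ≠ 0 := by
    intro h0
    simp [h0] at hpos
  have hmn : m ≠ n := by
    rintro rfl
    have hempty : cfaces Δ m = ∅ := by
      refine Finset.filter_eq_empty_iff.2 fun F hF hc => huniv ?_
      rwa [← (Finset.card_eq_iff_eq_univ F).1 (by simpa using hc)]
    have hrank := reducedHomologyRank_add_boundaryRank K hlow m
    rw [hempty, Finset.card_empty] at hrank
    omega
  rw [Finset.mem_range] at hm
  have hbetti : bettiNumber K Δ (n - m - 1) n ≠ 0 := by
    rw [bettiNumber_card]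
    convert hne using 2
    omega
  have h₁ := le_pdSR hbetti
  have h₂ : m + 1 ≤ regSR K Δ := le_regSR hbetti (by omega)
  obtain ⟨a, ha⟩ := hr
  obtain ⟨b, hb⟩ := hodd
  omega
end

section
/- Let H = C_n(j) be the circulant graph with 1 ≤ j ≤ ⌊n/2⌋, and set d = gcd(j, n). Then H is a chordal graph if and only if n = 2j or n = 3d. -/
/-- The circulant graph `C_n(S)`: the graph on the vertex set `ZMod n`
(identified with `{x_1, …, x_n}`) in which `x` and `y` are adjacent if and only
if they differ by `±s (mod n)` for some `s ∈ S`. -/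
def circulant (n : ℕ) (S : Set ℕ) : SimpleGraph (ZMod n) :=
  SimpleGraph.fromRel (fun x y => ∃ s ∈ S, y - x = (s : ZMod n))

/-- A graph is chordal if it has no induced cycle of length `m ≥ 4`.  Here an
induced `m`-cycle is an injection of the cycle `C_m = C_m(1)` whose image
induces exactly the cycle's adjacency. -/
def IsChordal {V : Type*} (G : SimpleGraph V) : Prop :=
  ∀ m : ℕ, 4 ≤ m → ¬ ∃ f : ZMod m → V, Function.Injective f ∧
    ∀ a b : ZMod m, G.Adj (f a) (f b) ↔ (circulant m {1}).Adj a b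

/-- A graph is claw-free if it has no induced subgraph isomorphic to the claw
`K_{1,3}`, i.e. there is no vertex adjacent to three pairwise non-adjacent
vertices. -/
def ClawFree {V : Type*} (G : SimpleGraph V) : Prop :=
  ¬ ∃ c x y z : V, x ≠ y ∧ x ≠ z ∧ y ≠ z ∧
    G.Adj c x ∧ G.Adj c y ∧ G.Adj c z ∧ ¬ G.Adj x y ∧ ¬ G.Adj x z ∧ ¬ G.Adj y z

theorem circulant_singleton_adj {n j : ℕ} {x y : ZMod n} :
    (circulant n {j}).Adj x y ↔ x ≠ y ∧ (y - x = (j : ZMod n) ∨ x - y = (j : ZMod n)) := by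
  simp [circulant, SimpleGraph.fromRel_adj]

/-- The multiples of `j` span an induced cycle of `C_n(j)`, whose length is the additive order of
`j` in `ZMod n`. -/
theorem exists_induced_cycle_circulant_singleton (n j : ℕ) :
    ∃ f : ZMod (addOrderOf (j : ZMod n)) → ZMod n, Function.Injective f ∧
      ∀ a b, (circulant n {j}).Adj (f a) (f b) ↔ (circulant _ {1}).Adj a b := by
  let g : ZMod (addOrderOf (j : ZMod n)) →+ ZMod n :=
    ZMod.lift _ ⟨zmultiplesHom _ (j : ZMod n), by
      rw [zmultiplesHom_apply, natCast_zsmul, addOrderOf_nsmul_eq_zero]⟩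
  have hg (k : ℤ) : g k = k • (j : ZMod n) := by simp [g]
  have hg1 : g 1 = j := by simpa using hg 1
  have hinj : Function.Injective g := by
    refine (injective_iff_map_eq_zero g).2 fun a ha => ?_
    obtain ⟨k, rfl⟩ := ZMod.intCast_surjective a
    rw [hg] at ha
    exact (ZMod.intCast_zmod_eq_zero_iff_dvd _ _).2 (addOrderOf_dvd_iff_zsmul_eq_zero.2 ha)
  have hgj (x) : g x = j ↔ x = 1 := by rw [← hinj.eq_iff, hg1]
  refine ⟨g, hinj, fun a b => ?_⟩
  rw [circulant_singleton_adj, circulant_singleton_adj, ← map_sub, ← map_sub, hgj, hgj,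
    hinj.ne_iff, Nat.cast_one]

/-- If any two distinct neighbours of every vertex are adjacent, then the graph is chordal. -/
theorem isChordal_of_adj_of_common_neighbor {V : Type*} {G : SimpleGraph V}
    (h : ∀ x y z, G.Adj x y → G.Adj x z → y ≠ z → G.Adj y z) : IsChordal G := by
  rintro m hm ⟨f, hf, hadj⟩
  have hne (k : ℕ) (hk : 0 < k) (hkm : k < m) : (k : ZMod m) ≠ 0 := fun h0 =>
    absurd (Nat.le_of_dvd hk ((ZMod.natCast_eq_zero_iff _ _).1 h0)) (by omega)
  have h1 := hne 1 (by omega) (by omega)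
  have h2 := hne 2 (by omega) (by omega)
  have h3 := hne 3 (by omega) (by omega)
  push_cast at h1 h2 h3
  have hp : G.Adj (f 0) (f 1) := by
    rw [hadj, circulant_singleton_adj]
    exact ⟨h1.symm, Or.inl (by simp)⟩
  have hq : G.Adj (f 0) (f (-1)) := by
    rw [hadj, circulant_singleton_adj]
    exact ⟨fun e => h1 (by linear_combination e), Or.inr (by simp)⟩
  have hpq := h _ _ _ hp hq (hf.ne fun e => h2 (by linear_combination e))
  rw [hadj, circulant_singleton_adj] at hpq
  obtain ⟨-, e | e⟩ := hpq <;> push_cast at e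
  · exact h3 (by linear_combination -e)
  · exact h1 (by linear_combination e)

/-- **Lemma (chordality of `C_n(j)`).**
Let `H = C_n(j)` with `1 ≤ j ≤ ⌊n/2⌋` and `d = gcd(j, n)`.  Then `H` is a
chordal graph if and only if `n = 2j` or `n = 3d`. -/
theorem circulant_single_jump_chordal_iff
    (n j : ℕ) (h1 : 1 ≤ j) (h2 : j ≤ n / 2) (d : ℕ) (hd : d = Nat.gcd j n) :
    IsChordal (circulant n {j}) ↔ (n = 2 * j ∨ n = 3 * d) := by
  constructor
  · intro hc
    by_contra! hn
    refine hc _ ?_ (exists_induced_cycle_circulant_singleton n j)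
    rw [ZMod.addOrderOf_coe _ (by omega), Nat.gcd_comm, ← hd]
    obtain ⟨k, hk⟩ : d ∣ j := hd ▸ Nat.gcd_dvd_left j n
    obtain ⟨m, hm⟩ : d ∣ n := hd ▸ Nat.gcd_dvd_right j n
    have hd0 : 0 < d := hd ▸ Nat.gcd_pos_of_pos_left n h1
    rw [hm, Nat.mul_div_cancel_left _ hd0]
    have hk0 : 0 < k := Nat.pos_of_ne_zero (by rintro rfl; omega)
    have hkm : 2 * k ≤ m := Nat.le_of_mul_le_mul_left (by lia : d * (2 * k) ≤ d * m) hd0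
    by_contra! hm4
    have hk1 : k = 1 := by omega
    subst hk1
    interval_cases m <;> omega
  · intro hn
    have hj : 2 * (j : ZMod n) = 0 ∨ 3 * (j : ZMod n) = 0 := by
      refine hn.imp (fun h => ?_) fun h => ?_
      · exact_mod_cast (ZMod.natCast_eq_zero_iff (2 * j) n).2 (dvd_of_eq h)
      · exact_mod_cast (ZMod.natCast_eq_zero_iff (3 * j) n).2
          (h ▸ mul_dvd_mul_left 3 (hd ▸ Nat.gcd_dvd_left j n))
    refine isChordal_of_adj_of_common_neighbor fun x y z hy hz hyz => ?_
    rw [circulant_singleton_adj] at hy hz ⊢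
    refine ⟨hyz, ?_⟩
    obtain ⟨-, hy | hy⟩ := hy <;> obtain ⟨-, hz | hz⟩ := hz
    · exact absurd (by linear_combination hy - hz) hyz
    · rcases hj with hj | hj
      · exact absurd (by linear_combination hy + hz + hj) hyz
      · exact Or.inl (by linear_combination -hy - hz - hj)
    · rcases hj with hj | hj
      · exact absurd (by linear_combination -hy - hz - hj) hyz
      · exact Or.inr (by linear_combination -hy - hz - hj)
    · exact absurd (by linear_combination hz - hy) hyz
end

section
/- Let G = C_n(1, ..., ĵ, ..., ⌊n/2⌋) be the circulant graph with connection set S = {1, ..., ⌊n/2⌋} \ {j} for some 1 ≤ j ≤ ⌊n/2⌋, and set d = gcd(j, n). If n/d ≥ 5, then G is claw-free, i.e., G has no induced subgraph isomorphic to the claw K_{1,3}. -/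
/-- Distinct vertices that are not adjacent in `C_n(1, …, ĵ, …, ⌊n/2⌋)` differ by `±j`. -/
theorem sub_eq_or_eq_neg_of_not_adj_circulant {n j : ℕ} (hn : n ≠ 0) {x y : ZMod n} (hxy : x ≠ y)
    (h : ¬ (circulant n {s | 1 ≤ s ∧ s ≤ n / 2 ∧ s ≠ j}).Adj x y) :
    y - x = (j : ZMod n) ∨ y - x = -(j : ZMod n) := by
  have : NeZero n := ⟨hn⟩
  simp only [circulant, SimpleGraph.fromRel_adj, Set.mem_ofPred_eq, not_and, not_or, not_exists] at h
  obtain ⟨hr, hl⟩ := h hxy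
  have hv : ((y - x).val : ZMod n) = y - x := ZMod.natCast_zmod_val _
  have hlt : (y - x).val < n := ZMod.val_lt _
  have hpos : (y - x).val ≠ 0 := by
    rw [Ne, ZMod.val_eq_zero, sub_eq_zero]
    exact hxy.symm
  have hneg : ((n - (y - x).val : ℕ) : ZMod n) = x - y := by
    rw [Nat.cast_sub hlt.le, hv, ZMod.natCast_self]
    ring
  by_cases hle : (y - x).val ≤ n / 2
  · left
    by_contra hne
    refine hr _ ⟨by omega, hle, fun hj => hne ?_⟩ hv.symm
    rw [← hj, hv]
  · right
    by_contra hne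
    refine hl _ ⟨by omega, by omega, fun hj => hne ?_⟩ hneg.symm
    rw [← hj, hneg]
    ring

/-- If `n / gcd(j, n) ≥ 4`, then `3j` is nonzero modulo `n`. -/
theorem three_mul_natCast_ne_zero {n j : ℕ} (h : 4 ≤ n / Nat.gcd j n) :
    (3 * j : ZMod n) ≠ 0 := by
  intro h0
  have hdvd : n ∣ j * 3 := by
    rw [← ZMod.natCast_eq_zero_iff]
    push_cast
    rw [mul_comm, h0]
  have hgcd : n ∣ Nat.gcd j n * 3 := by
    rw [← Nat.gcd_mul_right]
    exact Nat.dvd_gcd hdvd (Nat.dvd_mul_right n 3)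
  have hpos : 0 < Nat.gcd j n := by
    by_contra! hz
    simp [Nat.le_zero.mp hz] at h
  have hle := Nat.div_le_of_le_mul (Nat.le_of_dvd (by omega) hgcd)
  omega

/-- **Lemma (claw-freeness).**
Let `G = C_n(1, …, ĵ, …, ⌊n/2⌋)` be the circulant graph whose connection set is
`{1, …, ⌊n/2⌋} \ {j}` for some `1 ≤ j ≤ ⌊n/2⌋`, and let `d = gcd(j, n)`.
If `n/d ≥ 5`, then `G` is claw-free. -/
theorem circulant_omit_one_jump_clawfree
    (n j : ℕ) (h1 : 1 ≤ j) (h2 : j ≤ n / 2) (d : ℕ) (hd : d = Nat.gcd j n)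
    (h5 : 5 ≤ n / d) :
    ClawFree (circulant n {s | 1 ≤ s ∧ s ≤ n / 2 ∧ s ≠ j}) := by
  subst hd
  have hn : n ≠ 0 := by
    rintro rfl
    simp at h5
  have h3 : (3 * j : ZMod n) ≠ 0 := three_mul_natCast_ne_zero (by omega)
  rintro ⟨c, x, y, z, hxy, hxz, hyz, -, -, -, nxy, nxz, nyz⟩
  rcases sub_eq_or_eq_neg_of_not_adj_circulant hn hxy nxy with a | a <;>
  rcases sub_eq_or_eq_neg_of_not_adj_circulant hn hxz nxz with b | b <;>
  rcases sub_eq_or_eq_neg_of_not_adj_circulant hn hyz nyz with e | e <;>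
  grind
end

section
/- Let j ≥ 1 and let G = C_{4j}(1, ..., ĵ, ..., 2j) be the circulant graph on 4j vertices whose connection set is {1, ..., 2j} \ {j}. Then the co-chordal number of G equals 2, i.e., G can be written as the union of two subgraphs G_1 and G_2 (on the same vertex set, with E(G) = E(G_1) ∪ E(G_2)) such that both complements G_1^c and G_2^c are chordal, and G is not itself co-chordal. -/
theorem ZMod.sub_eq_natCast_iff_val {n : ℕ} [NeZero n] (a b : ZMod n) {s : ℕ} (hs : s ≤ n) :
    b - a = (s : ZMod n) ↔ b.val = a.val + s ∨ b.val + n = a.val + s := by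
  have ha := ZMod.val_lt a
  have hb := ZMod.val_lt b
  have h : b - a = (s : ZMod n) ↔ b.val % n = (a.val + s) % n := by
    rw [← Nat.ModEq, ← ZMod.natCast_eq_natCast_iff]
    push_cast
    rw [ZMod.natCast_rightInverse, ZMod.natCast_rightInverse, sub_eq_iff_eq_add, add_comm]
  rw [h, Nat.mod_eq_of_lt hb]
  rcases lt_or_ge (a.val + s) n with hlt | hge
  · rw [Nat.mod_eq_of_lt hlt]
    omega
  · rw [Nat.mod_eq_sub_mod hge, Nat.mod_eq_of_lt (by omega)]
    omega

theorem circulant_four_mul_adj_iff {j : ℕ} [NeZero (4 * j)] (a b : ZMod (4 * j)) :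
    (circulant (4 * j) {s | 1 ≤ s ∧ s ≤ 2 * j ∧ s ≠ j}).Adj a b ↔
      a ≠ b ∧ ¬ (b.val = a.val + j ∨ b.val = a.val + 3 * j ∨
        a.val = b.val + j ∨ a.val = b.val + 3 * j) := by
  have ha := ZMod.val_lt a
  have hb := ZMod.val_lt b
  rw [circulant, SimpleGraph.fromRel_adj]
  refine and_congr_right fun hne => ?_
  have hval : a.val ≠ b.val := fun h => hne (ZMod.val_injective _ h)
  constructor
  · rintro (⟨s, ⟨h1, h2, h3⟩, h⟩ | ⟨s, ⟨h1, h2, h3⟩, h⟩) <;>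
      rw [ZMod.sub_eq_natCast_iff_val _ _ (by omega)] at h <;> omega
  · intro h
    have key : ∀ x y : ZMod (4 * j), ∀ s, 1 ≤ s → s ≤ 2 * j → s ≠ j →
        (y.val = x.val + s ∨ y.val + 4 * j = x.val + s) →
        ∃ s ∈ {s | 1 ≤ s ∧ s ≤ 2 * j ∧ s ≠ j}, y - x = (s : ZMod (4 * j)) :=
      fun x y s h1 h2 h3 h4 =>
        ⟨s, ⟨h1, h2, h3⟩, (ZMod.sub_eq_natCast_iff_val _ _ (by omega)).2 h4⟩
    rcases lt_or_gt_of_ne hval with hlt | hlt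
    · rcases le_or_gt (b.val - a.val) (2 * j) with hle | hgt
      · exact .inl (key a b (b.val - a.val) (by omega) hle (by omega) (by omega))
      · exact .inr (key b a (a.val + 4 * j - b.val) (by omega) (by omega) (by omega) (by omega))
    · rcases le_or_gt (a.val - b.val) (2 * j) with hle | hgt
      · exact .inr (key b a (a.val - b.val) (by omega) hle (by omega) (by omega))
      · exact .inl (key a b (b.val + 4 * j - a.val) (by omega) (by omega) (by omega) (by omega))

theorem mod_eq_and_parity_div_ne_iff {j v w : ℕ} (hv : v < 4 * j) (hw : w < 4 * j) :
    (v % j = w % j ∧ v / j % 2 ≠ w / j % 2) ↔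
      (w = v + j ∨ w = v + 3 * j ∨ v = w + j ∨ v = w + 3 * j) := by
  have hj : 0 < j := by omega
  have hv' : v / j < 4 := Nat.div_lt_of_lt_mul (by omega)
  have hw' : w / j < 4 := Nat.div_lt_of_lt_mul (by omega)
  have ev := Nat.div_add_mod v j
  have ew := Nat.div_add_mod w j
  have rv := Nat.mod_lt v hj
  have rw' := Nat.mod_lt w hj
  generalize v / j = p at *
  generalize w / j = q at *
  generalize v % j = r at *
  generalize w % j = t at *
  interval_cases p <;> interval_cases q <;> omega

/-- The disjoint union, over the fibres of `c`, of the complete graphs from which all edges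
inside `P` have been deleted. -/
def splitFibreGraph {V C : Type*} (c : V → C) (P : V → Prop) : SimpleGraph V where
  Adj a b := a ≠ b ∧ c a = c b ∧ ¬ (P a ∧ P b)
  symm := ⟨fun _ _ h => ⟨h.1.symm, h.2.1.symm, fun hp => h.2.2 hp.symm⟩⟩
  loopless := ⟨fun _ h => h.1 rfl⟩

theorem circulant_one_adj_natCast_iff {m : ℕ} (hm : 4 ≤ m) {a b : ℕ} (hab : a < b)
    (hb : b ≤ 3) (h : b - a ≤ 2) :
    (circulant m {1}).Adj (a : ZMod m) (b : ZMod m) ↔ b = a + 1 := by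
  have : NeZero m := ⟨by omega⟩
  have hva : (a : ZMod m).val = a := ZMod.val_cast_of_lt (by omega)
  have hvb : (b : ZMod m).val = b := ZMod.val_cast_of_lt (by omega)
  have hne : (a : ZMod m) ≠ b := fun h => by
    have := congrArg ZMod.val h
    omega
  simp only [circulant, SimpleGraph.fromRel_adj, Set.mem_singleton_iff, exists_eq_left]
  rw [ZMod.sub_eq_natCast_iff_val _ _ (by omega), ZMod.sub_eq_natCast_iff_val _ _ (by omega),
    hva, hvb]
  constructor
  · omega
  · exact fun h => ⟨hne, by omega⟩

theorem isChordal_splitFibreGraph {V C : Type*} (c : V → C) (P : V → Prop) :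
    IsChordal (splitFibreGraph c P) := by
  rintro m hm ⟨f, hf, hadj⟩
  have h01 := (hadj (0 : ℕ) (1 : ℕ)).2
    ((circulant_one_adj_natCast_iff hm (by omega) (by omega) (by omega)).2 rfl)
  have h12 := (hadj (1 : ℕ) (2 : ℕ)).2
    ((circulant_one_adj_natCast_iff hm (by omega) (by omega) (by omega)).2 rfl)
  have h23 := (hadj (2 : ℕ) (3 : ℕ)).2
    ((circulant_one_adj_natCast_iff hm (by omega) (by omega) (by omega)).2 rfl)
  have both : ∀ a b : ℕ, a < b → b ≤ 3 → b - a = 2 → c (f a) = c (f b) → P (f a) ∧ P (f b) := by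
    intro a b hab hb h hc
    by_contra hP
    have hne : (a : ZMod m) ≠ b := fun h' => by
      have := congrArg ZMod.val h'
      rw [ZMod.val_cast_of_lt (by omega), ZMod.val_cast_of_lt (by omega)] at this
      omega
    have := (circulant_one_adj_natCast_iff hm hab hb h.le).1
      ((hadj a b).1 ⟨fun h' => hne (hf h'), hc, hP⟩)
    omega
  have h02 := both 0 2 (by omega) (by omega) rfl (h01.2.1.trans h12.2.1)
  have h13 := both 1 3 (by omega) (by omega) rfl (h12.2.1.trans h23.2.1)
  exact h01.2.2 ⟨h02.1, h13.1⟩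

/-- **Claim (from the proof of Theorem 3.3): `co-chord(C_{4j}(1, …, ĵ, …, 2j)) = 2`.**
Let `j ≥ 1` and let `G = C_{4j}(1, …, ĵ, …, 2j)` be the circulant graph on `4j`
vertices whose connection set is `{1, …, 2j} \ {j}`.  Then `G` is the union of
two subgraphs `G_1` and `G_2` (on the same vertex set, with
`E(G) = E(G_1) ∪ E(G_2)`) whose complements are both chordal, while `G` itself
is not co-chordal; that is, the co-chordal number of `G` equals `2`. -/
theorem cochordal_number_of_C4j_eq_two (j : ℕ) (hj : 1 ≤ j) :
    (∃ G₁ G₂ : SimpleGraph (ZMod (4 * j)),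
      circulant (4 * j) {s | 1 ≤ s ∧ s ≤ 2 * j ∧ s ≠ j} = G₁ ⊔ G₂ ∧
      IsChordal G₁ᶜ ∧ IsChordal G₂ᶜ) ∧
    ¬ IsChordal (circulant (4 * j) {s | 1 ≤ s ∧ s ≤ 2 * j ∧ s ≠ j})ᶜ := by
  have : NeZero (4 * j) := ⟨by omega⟩
  constructor
  · let H (i : ℕ) : SimpleGraph (ZMod (4 * j)) :=
      splitFibreGraph (fun a => a.val % j) (fun a => a.val / j % 2 = i)
    refine ⟨(H 0)ᶜ, (H 1)ᶜ, ?_, ?_, ?_⟩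
    · ext a b
      rw [circulant_four_mul_adj_iff,
        ← mod_eq_and_parity_div_ne_iff (ZMod.val_lt a) (ZMod.val_lt b)]
      simp only [SimpleGraph.sup_adj, SimpleGraph.compl_adj, H, splitFibreGraph]
      have ha := Nat.mod_two_eq_zero_or_one (a.val / j)
      have hb := Nat.mod_two_eq_zero_or_one (b.val / j)
      grind
    · rw [compl_compl]
      exact isChordal_splitFibreGraph _ _
    · rw [compl_compl]
      exact isChordal_splitFibreGraph _ _
  · intro h
    let f (k : ZMod 4) : ZMod (4 * j) := ((k.val * j : ℕ) : ZMod (4 * j))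
    have hval : ∀ k, (f k).val = k.val * j := fun k =>
      ZMod.val_cast_of_lt (Nat.mul_lt_mul_of_pos_right (ZMod.val_lt k) hj)
    have hf : Function.Injective f := fun k l hkl => by
      have := congrArg ZMod.val hkl
      rw [hval, hval] at this
      exact ZMod.val_injective _ (Nat.eq_of_mul_eq_mul_right hj this)
    refine h 4 le_rfl ⟨f, hf, fun a b => ?_⟩
    rw [SimpleGraph.compl_adj, circulant_four_mul_adj_iff, hf.ne_iff, hval, hval]
    simp only [circulant, SimpleGraph.fromRel_adj, Set.mem_singleton_iff, exists_eq_left]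
    rw [ZMod.sub_eq_natCast_iff_val _ _ (by omega), ZMod.sub_eq_natCast_iff_val _ _ (by omega),
      ← (ZMod.val_injective 4).ne_iff]
    have ha := ZMod.val_lt a
    have hb := ZMod.val_lt b
    generalize a.val = p at *
    generalize b.val = q at *
    interval_cases p <;> interval_cases q <;> omega
end

section
/- Let t ≥ 1 and let A_t be the graph consisting of a ladder with t squares together with a pendant edge extending each of the two paths at one end: vertices a_0, ..., a_{t+1} and b_0, ..., b_{t+1}, with edges a_i a_{i+1} and b_i b_{i+1} for 0 ≤ i ≤ t, and rungs a_i b_i for 1 ≤ i ≤ t+1. Then the edge ideal I(A_t) satisfies reg(I(A_t)) ≤ (t+4)/2 if t is even and reg(I(A_t)) ≤ (t+3)/2 if t is odd. -/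
open Classical in
/-- The independence complex `Ind(G)` of a finite simple graph `G`, recorded
as a simplicial complex on `Fin (card V)` via a fixed identification of the
vertices with `Fin (card V)`.  It is the Stanley–Reisner complex of the edge
ideal `I(G)`. -/
noncomputable def indComplex {V : Type*} [Fintype V] (G : SimpleGraph V) :
    Finset (Finset (Fin (Fintype.card V))) :=
  Finset.univ.filter (fun F : Finset (Fin (Fintype.card V)) =>
    ∀ u ∈ F, ∀ v ∈ F,
      ¬ G.Adj ((Fintype.equivFin V).symm u) ((Fintype.equivFin V).symm v))

/-- The Castelnuovo–Mumford regularity `reg(I(G))` of the edge ideal of the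
finite simple graph `G` over the field `K`, computed (via Hochster's formula)
from the independence complex of `G`. -/
noncomputable def regEdgeIdeal (K : Type*) [Field K] {V : Type*} [Fintype V]
    (G : SimpleGraph V) : ℕ :=
  regSR K (indComplex G)

/-- The projective dimension `pd(I(G))` of the edge ideal of the finite simple
graph `G` over the field `K`, computed (via Hochster's formula) from the
independence complex of `G`. -/
noncomputable def pdEdgeIdeal (K : Type*) [Field K] {V : Type*} [Fintype V]
    (G : SimpleGraph V) : ℕ :=
  pdSR K (indComplex G)

/-- The graph `A_t`: a ladder with `t` squares together with a pendant edge
extending each of the two horizontal paths at one end.  The vertices are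
`a_0, …, a_{t+1}` (the row `(true, i) = a_i`) and `b_0, …, b_{t+1}` (the row
`(false, i) = b_i`), with edges `a_i a_{i+1}` and `b_i b_{i+1}` for
`0 ≤ i ≤ t`, and rungs `a_i b_i` for `1 ≤ i ≤ t+1`. -/
def graphA (t : ℕ) : SimpleGraph (Bool × Fin (t + 2)) :=
  SimpleGraph.fromRel (fun x y =>
    (x.1 = y.1 ∧ (y.2 : ℕ) = (x.2 : ℕ) + 1) ∨
    (x.2 = y.2 ∧ 1 ≤ (x.2 : ℕ) ∧ x.1 ≠ y.1))

/-- The ladder graph `B_t` with `t` squares: vertices `a_1, …, a_{t+1}` (the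
row `(true, i) = a_{i+1}`) and `b_1, …, b_{t+1}` (the row
`(false, i) = b_{i+1}`), with edges `a_i a_{i+1}` and `b_i b_{i+1}` for
`1 ≤ i ≤ t`, and rungs `a_i b_i` for `1 ≤ i ≤ t+1`. -/
def graphB (t : ℕ) : SimpleGraph (Bool × Fin (t + 1)) :=
  SimpleGraph.fromRel (fun x y =>
    (x.1 = y.1 ∧ (y.2 : ℕ) = (x.2 : ℕ) + 1) ∨
    (x.2 = y.2 ∧ x.1 ≠ y.1))

/-- The graph `D_t`: a ladder with `t` squares together with one pendant edge
extending the bottom path on the left and one pendant edge extending the top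
path on the right.  The vertices are `a_1, …, a_{t+2}` (the top row
`(true, i) = a_{i+1}`) and `b_0, …, b_{t+1}` (the bottom row
`(false, i) = b_i`), with edges `a_i a_{i+1}` for `1 ≤ i ≤ t+1`, edges
`b_i b_{i+1}` for `0 ≤ i ≤ t`, and rungs `a_i b_i` for `1 ≤ i ≤ t+1`. -/
def graphD (t : ℕ) : SimpleGraph (Bool × Fin (t + 2)) :=
  SimpleGraph.fromRel (fun x y =>
    (y.2 : ℕ) = (x.2 : ℕ) + 1 ∧ (x.1 = y.1 ∨ (x.1 = true ∧ y.1 = false)))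

section Chains

variable {K : Type*} [Field K] {n : ℕ}

/-- The incidence sign of the vertex `v` with respect to the set `F`. -/
def incSign (K : Type*) [Field K] {n : ℕ} (v : Fin n) (F : Finset (Fin n)) : K :=
  (-1 : K) ^ (F.filter (fun w => w < v)).card

/-- The simplicial boundary operator on the chains of the full simplex. -/
def fullBoundary (f : Finset (Fin n) → K) (G : Finset (Fin n)) : K :=
  ∑ v ∈ Gᶜ, incSign K v G * f (insert v G)

/-- The cone operator with apex `v` on the chains of the full simplex. -/
def coneOp (v : Fin n) (f : Finset (Fin n) → K) (F : Finset (Fin n)) : K :=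
  if v ∈ F then incSign K v (F.erase v) * f (F.erase v) else 0

theorem incSign_mul_self (v : Fin n) (F : Finset (Fin n)) :
    incSign K v F * incSign K v F = 1 := by
  unfold incSign
  rw [← mul_pow]
  simp

theorem incSign_insert_self (v : Fin n) (F : Finset (Fin n)) :
    incSign K v (insert v F) = incSign K v F := by
  simp [incSign, Finset.filter_insert]

theorem incSign_insert {v w : Fin n} {F : Finset (Fin n)} (hw : w ∉ F) :
    incSign K v (insert w F) = (if w < v then -1 else 1) * incSign K v F := by
  unfold incSign
  rw [Finset.filter_insert]
  split_ifs
  · rw [Finset.card_insert_of_notMem (by simp [hw]), pow_succ]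
    ring
  · simp

theorem incSign_mul_insert {v w : Fin n} {F : Finset (Fin n)} (hv : v ∉ F) (hw : w ∉ F)
    (hvw : w ≠ v) :
    incSign K w (insert v F) * incSign K v (insert w F) =
      -(incSign K v F * incSign K w F) := by
  rw [incSign_insert hv, incSign_insert hw]
  rcases lt_or_gt_of_ne hvw with h | h
  · rw [if_neg h.not_gt, if_pos h]; ring
  · rw [if_pos h, if_neg h.not_gt]; ring

theorem fullBoundary_add (f g : Finset (Fin n) → K) :
    fullBoundary (f + g) = fullBoundary f + fullBoundary g := by
  funext G
  simp [fullBoundary, mul_add, Finset.sum_add_distrib]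

theorem fullBoundary_sub (f g : Finset (Fin n) → K) :
    fullBoundary (f - g) = fullBoundary f - fullBoundary g := by
  funext G
  simp [fullBoundary, mul_sub, Finset.sum_sub_distrib]

theorem coneOp_zero (v : Fin n) : coneOp v (0 : Finset (Fin n) → K) = 0 := by
  funext F
  simp [coneOp]

/-- The cone operator is a contracting homotopy of the full simplex. -/
theorem fullBoundary_coneOp (v : Fin n) (f : Finset (Fin n) → K) :
    fullBoundary (coneOp v f) = f - coneOp v (fullBoundary f) := by
  funext G
  by_cases hv : v ∈ G
  · obtain ⟨H, hH, rfl⟩ : ∃ H, v ∉ H ∧ insert v H = G :=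
      ⟨G.erase v, by simp, Finset.insert_erase hv⟩
    have hc : Hᶜ = insert v (insert v H)ᶜ := by
      ext w
      by_cases h : w = v <;> simp [h, hH]
    simp only [Pi.sub_apply, coneOp, Finset.mem_insert_self, if_true,
      Finset.erase_insert hH, fullBoundary]
    rw [hc, Finset.sum_insert (by simp), mul_add, ← mul_assoc, incSign_mul_self, one_mul,
      sub_add_eq_sub_sub, sub_self, zero_sub, Finset.mul_sum, ← Finset.sum_neg_distrib]
    refine Finset.sum_congr rfl fun w hw => ?_
    simp only [Finset.mem_compl, Finset.mem_insert, not_or] at hw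
    rw [if_pos (by simp), Finset.insert_comm, Finset.erase_insert (by simp [hH, Ne.symm hw.1]),
      ← mul_assoc, incSign_mul_insert hH hw.2 hw.1]
    ring
  · simp only [Pi.sub_apply, fullBoundary]
    rw [Finset.sum_eq_single v]
    · simp [coneOp, hv, ← mul_assoc, incSign_mul_self]
    · intro w _ hw
      simp [coneOp, hv, Ne.symm hw]
    · simp [hv]

/-- Every cycle of `Δ` carried by faces of cardinality `k` is a boundary in `Δ`. -/
def ExactAt (K : Type*) [Field K] {n : ℕ} (Δ : Set (Finset (Fin n))) (k : ℕ) : Prop :=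
  ∀ z : Finset (Fin n) → K, (∀ F, z F ≠ 0 → F ∈ Δ ∧ F.card = k) → fullBoundary z = 0 →
    ∃ y : Finset (Fin n) → K, (∀ F, y F ≠ 0 → F ∈ Δ ∧ F.card = k + 1) ∧ fullBoundary y = z

theorem exactAt_of_card_ne {Δ : Set (Finset (Fin n))} {k : ℕ} (h : ∀ F ∈ Δ, F.card ≠ k) :
    ExactAt K Δ k := by
  intro z hz _
  have hz0 : z = 0 := by
    funext F
    by_contra hF
    exact h F (hz F hF).1 (hz F hF).2
  exact ⟨0, by simp, by funext G; simp [fullBoundary, hz0]⟩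

theorem exactAt_of_cone {Δ : Set (Finset (Fin n))} {v : Fin n}
    (h : ∀ F ∈ Δ, insert v F ∈ Δ) (k : ℕ) : ExactAt K Δ k := by
  intro z hz hz0
  refine ⟨coneOp v z, fun F hF => ?_, by rw [fullBoundary_coneOp, hz0, coneOp_zero, sub_zero]⟩
  by_cases hv : v ∈ F
  · simp only [coneOp, hv, if_true] at hF
    obtain ⟨h1, h2⟩ := hz _ (right_ne_zero_of_mul hF)
    refine ⟨by simpa [Finset.insert_erase hv] using h _ h1, ?_⟩
    rw [← h2, Finset.card_erase_add_one hv]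
  · simp [coneOp, hv] at hF

/-- Exactness of the deletion and of the link of a vertex gives exactness of the complex. -/
theorem ExactAt.of_deletion_link {Δ : Set (Finset (Fin n))} (hΔ : IsLowerSet Δ) (v : Fin n) {k : ℕ}
    (hdel : ExactAt K {F | F ∈ Δ ∧ v ∉ F} (k + 1))
    (hlink : ExactAt K {F | v ∉ F ∧ insert v F ∈ Δ} k) : ExactAt K Δ (k + 1) := by
  intro z hz hz0
  set z₁ : Finset (Fin n) → K := fun F => if v ∈ F then 0 else incSign K v F * z (insert v F)
    with hz₁
  set z₀ : Finset (Fin n) → K := fun F => if v ∈ F then 0 else z F with hz₀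
  have hsum : z = z₀ + coneOp v z₁ := by
    funext F
    by_cases hv : v ∈ F
    · simp [hz₀, hz₁, coneOp, hv, Finset.insert_erase, ← mul_assoc, incSign_mul_self]
    · simp [hz₀, coneOp, hv]
  have hfree : ∀ f : Finset (Fin n) → K, (∀ F, v ∈ F → f F = 0) →
      ∀ F, v ∈ F → fullBoundary f F = 0 := by
    intro f hf F hF
    exact Finset.sum_eq_zero fun w _ => by rw [hf _ (Finset.mem_insert_of_mem hF), mul_zero]
  have hD : fullBoundary z₀ + (z₁ - coneOp v (fullBoundary z₁)) = 0 := by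
    rw [← fullBoundary_coneOp, ← fullBoundary_add, ← hsum, hz0]
  have hz₁cycle : fullBoundary z₁ = 0 := by
    funext F
    by_cases hv : v ∈ F
    · exact hfree z₁ (fun F hF => by simp [hz₁, hF]) F hv
    · have h := congrFun hD (insert v F)
      have h0 := hfree z₀ (fun F hF => by simp [hz₀, hF]) (insert v F) (by simp)
      simp only [Pi.add_apply, Pi.sub_apply, h0, Pi.zero_apply] at h
      have h1 : z₁ (insert v F) = 0 := by simp [hz₁]
      simp only [h1, coneOp, Finset.mem_insert_self, if_true, Finset.erase_insert hv, zero_add,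
        zero_sub, neg_eq_zero] at h
      have h2 : incSign K v F ≠ 0 := by simp [incSign]
      simpa [h2] using h
  have hD' : fullBoundary z₀ + z₁ = 0 := by
    simpa [hz₁cycle, coneOp_zero] using hD
  obtain ⟨y₁, hy₁, hy₁z⟩ := hlink z₁ (fun F hF => by
    by_cases hv : v ∈ F
    · simp [hz₁, hv] at hF
    · simp only [hz₁, hv, if_false] at hF
      obtain ⟨h1, h2⟩ := hz _ (right_ne_zero_of_mul hF)
      rw [Finset.card_insert_of_notMem hv] at h2
      exact ⟨⟨hv, h1⟩, by omega⟩) hz₁cycle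
  obtain ⟨y₀, hy₀, hy₀z⟩ := hdel (z₀ + y₁) (fun F hF => by
    by_cases h1 : y₁ F = 0
    · simp only [Pi.add_apply, h1, add_zero] at hF
      by_cases hv : v ∈ F
      · simp [hz₀, hv] at hF
      · simp only [hz₀, hv, if_false] at hF
        exact ⟨⟨(hz F hF).1, hv⟩, (hz F hF).2⟩
    · obtain ⟨⟨hv, h2⟩, h3⟩ := hy₁ F h1
      exact ⟨⟨hΔ (Finset.subset_insert v F) h2, hv⟩, h3⟩)
    (by rw [fullBoundary_add, hy₁z, hD'])
  refine ⟨y₀ - coneOp v y₁, fun F hF => ?_, ?_⟩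
  · by_cases h0 : y₀ F = 0
    · by_cases hv : v ∈ F
      · simp only [Pi.sub_apply, h0, coneOp, hv, if_true, zero_sub, neg_ne_zero] at hF
        obtain ⟨⟨_, h2⟩, h3⟩ := hy₁ _ (right_ne_zero_of_mul hF)
        rw [Finset.insert_erase hv] at h2
        refine ⟨h2, ?_⟩
        rw [← h3, Finset.card_erase_add_one hv]
      · simp [h0, coneOp, hv] at hF
    · exact ⟨(hy₀ F h0).1.1, (hy₀ F h0).2⟩
  · rw [fullBoundary_sub, fullBoundary_coneOp, hy₀z, hy₁z, hsum]
    abel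

theorem sum_bcoeff_mul (f : Finset (Fin n) → K) (G : Finset (Fin n)) :
    ∑ F, bcoeff K F G * f F = fullBoundary f G := by
  have key : ∀ F : Finset (Fin n), bcoeff K F G * f F =
      ∑ v, if v ∈ Gᶜ ∧ F = insert v G then incSign K v G * f (insert v G) else 0 := by
    intro F
    rw [bcoeff, Finset.sum_mul, ← Finset.sum_subset (Finset.subset_univ F)]
    · refine Finset.sum_congr rfl fun v hv => ?_
      by_cases h : F.erase v = G
      · subst h
        rw [if_pos rfl, if_pos ⟨by simp, (Finset.insert_erase hv).symm⟩,
          Finset.insert_erase hv, ← incSign_insert_self, Finset.insert_erase hv, incSign]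
      · rw [if_neg h, if_neg, zero_mul]
        rintro ⟨h1, rfl⟩
        exact h (Finset.erase_insert (by simpa using h1))
    · intro v _ hv
      refine if_neg ?_
      rintro ⟨_, rfl⟩
      simp at hv
  simp_rw [key]
  rw [Finset.sum_comm, fullBoundary, ← Finset.sum_subset (Finset.subset_univ Gᶜ)]
  · refine Finset.sum_congr rfl fun v hv => ?_
    simp [hv]
  · intro v _ hv
    simp [hv]

theorem boundaryMap_apply_s10 (Δ : Finset (Finset (Fin n))) (m : ℕ) (f : Finset (Fin n) → K)
    (hf : ∀ F, f F ≠ 0 → F ∈ cfaces Δ (m + 1)) (G : {G // G ∈ cfaces Δ m}) :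
    boundaryMap K Δ m (fun F => f F.1) G = fullBoundary f G.1 := by
  rw [← sum_bcoeff_mul, boundaryMap]
  simp only [LinearMap.pi_apply, LinearMap.sum_apply, LinearMap.smul_apply, LinearMap.proj_apply,
    smul_eq_mul]
  rw [Finset.sum_coe_sort (cfaces Δ (m + 1)) (fun F => bcoeff K F G.1 * f F)]
  refine Finset.sum_subset (Finset.subset_univ _) fun F _ hF => ?_
  rw [not_not.1 fun h => hF (hf F h), mul_zero]

theorem reducedHomologyRank_eq_zero (Δ : Finset (Finset (Fin n)))
    (hΔ : IsLowerSet (Δ : Set (Finset (Fin n)))) (i : ℕ)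
    (h : ExactAt K (Δ : Set (Finset (Fin n))) (i + 1)) :
    reducedHomologyRank K Δ (i : ℤ) = 0 := by
  rw [reducedHomologyRank, if_neg (by omega), if_pos (by omega), Int.toNat_natCast]
  suffices hle : LinearMap.ker (boundaryMap K Δ i) ≤ LinearMap.range (boundaryMap K Δ (i + 1)) by
    rw [Submodule.comap_subtype_eq_top.2 hle]
    exact Module.finrank_zero_of_subsingleton
  intro f hf
  rw [LinearMap.mem_ker] at hf
  set z : Finset (Fin n) → K := fun F =>
    if hF : F ∈ cfaces Δ (i + 1) then f ⟨F, hF⟩ else 0 with hz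
  have hzsupp : ∀ F, z F ≠ 0 → F ∈ cfaces Δ (i + 1) := by
    intro F hF
    by_contra hn
    simp [hz, hn] at hF
  have hzf : (fun F : {F // F ∈ cfaces Δ (i + 1)} => z F.1) = f := by
    funext F
    simp [hz, F.2]
  have hcycle : fullBoundary z = 0 := by
    funext G
    by_cases hG : G ∈ cfaces Δ i
    · have := boundaryMap_apply_s10 Δ i z hzsupp ⟨G, hG⟩
      rw [hzf, hf] at this
      exact this.symm
    · refine Finset.sum_eq_zero fun v hv => ?_
      rw [Finset.mem_compl] at hv
      have : z (insert v G) = 0 := by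
        by_contra hne
        have := hzsupp _ hne
        simp only [cfaces, Finset.mem_filter, Finset.card_insert_of_notMem hv] at this
        refine hG (Finset.mem_filter.2 ⟨?_, by omega⟩)
        exact hΔ (Finset.subset_insert v G) this.1
      rw [this, mul_zero]
  obtain ⟨y, hy, hyz⟩ := h z (fun F hF => by simpa [cfaces] using hzsupp F hF) hcycle
  refine LinearMap.mem_range.2 ⟨fun F => y F.1, ?_⟩
  funext G
  rw [boundaryMap_apply_s10 Δ (i + 1) y (fun F hF => by simpa [cfaces] using hy F hF), hyz, ← hzf]

theorem regSR_le {Δ : Finset (Finset (Fin n))} (hΔ : IsLowerSet (Δ : Set (Finset (Fin n)))) {r : ℕ}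
    (h : ∀ (W : Finset (Fin n)) (k : ℕ), r ≤ k → ExactAt K {F | F ∈ Δ ∧ F ⊆ W} k) (hr : 1 ≤ r) :
    regSR K Δ ≤ r := by
  refine csSup_le' ?_
  rintro d ⟨i, j, hb, hd⟩
  by_contra hlt
  refine hb (Finset.sum_eq_zero fun W _ => ?_)
  have hd' : (j : ℤ) - i - 2 = ((d - 2 : ℕ) : ℤ) := by omega
  rw [hd']
  refine reducedHomologyRank_eq_zero _ ?_ _ ?_
  · intro F F' hF' hF
    simp only [Finset.coe_filter, Set.mem_ofPred_eq] at hF ⊢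
    exact ⟨hΔ hF' hF.1, hF'.trans hF.2⟩
  · simpa only [Finset.coe_filter] using h W (d - 2 + 1) (by omega)

end Chains

section Independence

variable {K : Type*} [Field K] {V : Type*} {n : ℕ}

/-- The independence complex of the subgraph of `G` induced on `S`, with the vertices
labelled by `e`. -/
def indOn (G : SimpleGraph V) (e : V ≃ Fin n) (S : Set V) : Set (Finset (Fin n)) :=
  {F | (∀ u ∈ F, e.symm u ∈ S) ∧ ∀ u ∈ F, ∀ v ∈ F, ¬ G.Adj (e.symm u) (e.symm v)}

theorem isLowerSet_indOn (G : SimpleGraph V) (e : V ≃ Fin n) (S : Set V) :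
    IsLowerSet (indOn G e S) := by
  intro F F' hF' hF
  exact ⟨fun u hu => hF.1 u (hF' hu), fun u hu v hv => hF.2 u (hF' hu) v (hF' hv)⟩

theorem exactAt_indOn_empty (G : SimpleGraph V) (e : V ≃ Fin n) {k : ℕ} (hk : k ≠ 0) :
    ExactAt K (indOn G e ∅) k := by
  refine exactAt_of_card_ne fun F hF => ?_
  rw [Finset.eq_empty_of_forall_notMem fun u hu => hF.1 u hu]
  simpa using hk.symm

theorem exactAt_indOn_of_isolated {G : SimpleGraph V} (e : V ≃ Fin n) {S : Set V} {v : V}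
    (hv : v ∈ S) (h : ∀ w ∈ S, ¬ G.Adj v w) (k : ℕ) : ExactAt K (indOn G e S) k := by
  refine exactAt_of_cone (Δ := indOn G e S) (v := e v) (fun F hF => ⟨?_, ?_⟩) k
  · intro u hu
    rcases Finset.mem_insert.1 hu with rfl | hu
    · simpa using hv
    · exact hF.1 u hu
  · intro u hu w hw
    rcases Finset.mem_insert.1 hu with rfl | hu <;> rcases Finset.mem_insert.1 hw with rfl | hw
    · simp
    · simpa using h _ (hF.1 w hw)
    · simpa [G.adj_comm] using h _ (hF.1 u hu)
    · exact hF.2 u hu w hw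

theorem exactAt_indOn_of_deletion_link {G : SimpleGraph V} (e : V ≃ Fin n) {S : Set V} {v : V}
    (hv : v ∈ S) {k : ℕ} (hdel : ExactAt K (indOn G e (S \ {v})) (k + 1))
    (hlink : ExactAt K (indOn G e {w | w ∈ S ∧ w ≠ v ∧ ¬ G.Adj v w}) k) :
    ExactAt K (indOn G e S) (k + 1) := by
  have hmem : ∀ F : Finset (Fin n), e v ∉ F ↔ ∀ u ∈ F, e.symm u ≠ v := by
    intro F
    constructor
    · rintro h u hu rfl
      simp [hu] at h
    · intro h hu
      exact h _ hu (by simp)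
  refine ExactAt.of_deletion_link (isLowerSet_indOn G e S) (e v) ?_ ?_
  · convert hdel using 1
    ext F
    simp only [indOn, Set.mem_ofPred_eq, hmem, Set.mem_sdiff, Set.mem_singleton_iff]
    grind
  · convert hlink using 1
    ext F
    simp only [indOn, Set.mem_ofPred_eq, hmem, Finset.mem_insert, forall_eq_or_imp,
      Equiv.symm_apply_apply, SimpleGraph.irrefl, not_false_eq_true, true_and]
    constructor
    · rintro ⟨h1, ⟨h2, h3⟩, h4, h5⟩
      exact ⟨fun u hu => ⟨h3 u hu, h1 u hu, h4 u hu⟩, fun u hu w hw => (h5 u hu).2 w hw⟩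
    · rintro ⟨h1, h2⟩
      exact ⟨fun u hu => (h1 u hu).2.1, ⟨hv, fun u hu => (h1 u hu).1⟩,
        fun u hu => (h1 u hu).2.2, fun u hu => ⟨fun h => (h1 u hu).2.2 h.symm, h2 u hu⟩⟩

end Independence

theorem graphA_adj {t : ℕ} {x y : Bool × Fin (t + 2)} :
    (graphA t).Adj x y ↔
      (x.1 = y.1 ∧ ((y.2 : ℕ) = x.2 + 1 ∨ (x.2 : ℕ) = y.2 + 1)) ∨
      (x.1 ≠ y.1 ∧ 1 ≤ (x.2 : ℕ) ∧ (x.2 : ℕ) = y.2) := by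
  obtain ⟨a, i⟩ := x
  obtain ⟨b, j⟩ := y
  simp only [graphA, SimpleGraph.fromRel_adj, ne_eq, Prod.mk.injEq, Fin.ext_iff]
  grind

theorem bool_pigeonhole (a b c : Bool) : a = b ∨ a = c ∨ b = c := by
  revert a b c
  decide

theorem exactAt_indOn_graphA {K : Type*} [Field K] {t n : ℕ} (e : Bool × Fin (t + 2) ≃ Fin n)
    (c : ℕ) : ∀ (s : ℕ) (S : Set (Bool × Fin (t + 2))), (∀ x ∈ S, s ≤ (x.2 : ℕ)) →
      (∀ x ∈ S, ∀ y ∈ S, (x.2 : ℕ) = s → (y.2 : ℕ) = s → ¬ (graphA t).Adj x y) →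
      t + 1 ≤ s + 2 * c → ∀ k, c + 1 ≤ k → ExactAt K (indOn (graphA t) e S) k := by
  induction c with
  | zero =>
    intro s S hS hcol hst k hk
    rcases S.eq_empty_or_nonempty with rfl | ⟨x, hx⟩
    · exact exactAt_indOn_empty _ e (by omega)
    · have hs : ∀ y ∈ S, (y.2 : ℕ) = s := fun y hy => by
        have := hS y hy
        have := y.2.2
        omega
      exact exactAt_indOn_of_isolated e hx
        (fun y hy => hcol x hx y hy (hs x hx) (hs y hy)) k
  | succ c ih =>
    have hrung : ∀ (s : ℕ) (S : Set (Bool × Fin (t + 2))), (∀ x ∈ S, s ≤ (x.2 : ℕ)) →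
        t + 1 ≤ s + 2 * c → ∀ k, c + 2 ≤ k → ExactAt K (indOn (graphA t) e S) k := by
      intro s S hS hst k hk
      by_cases hcol : ∀ x ∈ S, ∀ y ∈ S, (x.2 : ℕ) = s → (y.2 : ℕ) = s → ¬ (graphA t).Adj x y
      · exact ih s S hS hcol hst k (by omega)
      · push Not at hcol
        obtain ⟨x, hx, y, hy, hxs, hys, hxy⟩ := hcol
        obtain ⟨k, rfl⟩ : ∃ m, k = m + 1 := ⟨k - 1, by omega⟩
        rw [graphA_adj] at hxy
        refine exactAt_indOn_of_deletion_link e hx ?_ ?_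
        · refine ih s _ (fun z hz => hS z hz.1) ?_ hst _ (by omega)
          rintro z ⟨hz, hzx⟩ w ⟨hw, hwx⟩ hzs hws
          simp only [Set.mem_singleton_iff, Prod.ext_iff, Fin.ext_iff] at hzx hwx
          have hb := bool_pigeonhole x.1 z.1 w.1
          rw [graphA_adj]
          grind
        · refine ih s _ (fun z hz => hS z hz.1) ?_ hst _ (by omega)
          rintro z ⟨hz, hzx, hz'⟩ w ⟨hw, hwx, hw'⟩ hzs hws
          rw [ne_eq, Prod.ext_iff, Fin.ext_iff] at hzx hwx
          rw [graphA_adj] at hz' hw' ⊢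
          grind
    intro s S
    induction hN : S.ncard using Nat.strong_induction_on generalizing S with
    | _ N ihN =>
    subst hN
    intro hS hcol hst k hk
    have hpend : ∀ T ⊆ S, (∀ x ∈ T, (x.2 : ℕ) ≠ s + 1) → ∀ x ∈ T, (x.2 : ℕ) = s → ∀ m,
        ExactAt K (indOn (graphA t) e T) m := by
      intro T hTS hT x hx hxs m
      refine exactAt_indOn_of_isolated e hx (fun y hy hxy => ?_) m
      have h1 := hT y hy
      have h2 := hS y (hTS hy)
      have h3 := hcol x (hTS hx) y (hTS hy) hxs
      have h4 := graphA_adj.1 hxy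
      grind
    by_cases hmid : ∃ v ∈ S, (v.2 : ℕ) = s + 1
    · obtain ⟨v, hv, hvs⟩ := hmid
      obtain ⟨k, rfl⟩ : ∃ m, k = m + 1 := ⟨k - 1, by omega⟩
      refine exactAt_indOn_of_deletion_link e hv ?_ ?_
      · exact ihN _ (Set.ncard_sdiff_singleton_lt_of_mem hv) (S \ {v}) rfl
          (fun x hx => hS x hx.1) (fun x hx y hy => hcol x hx.1 y hy.1) hst _ hk
      · set T := {w | w ∈ S ∧ w ≠ v ∧ ¬ (graphA t).Adj v w}
        have hT : ∀ x ∈ T, (x.2 : ℕ) ≠ s + 1 := by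
          rintro x ⟨hx, hxv, hx'⟩ hxs
          rw [graphA_adj] at hx'
          rw [ne_eq, Prod.ext_iff, Fin.ext_iff] at hxv
          grind
        by_cases hleft : ∃ x ∈ T, (x.2 : ℕ) = s
        · obtain ⟨x, hx, hxs⟩ := hleft
          exact hpend T (fun x hx => hx.1) hT x hx hxs _
        · push Not at hleft
          refine ih (s + 2) T (fun x hx => ?_) ?_ (by omega) _ (by omega)
          · have := hS x hx.1
            have := hT x hx
            have := hleft x hx
            omega
          · rintro x ⟨hx, -, hx'⟩ y ⟨hy, -, hy'⟩ hxs hys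
            have hb := bool_pigeonhole v.1 x.1 y.1
            clear_value T
            rw [graphA_adj] at hx' hy' ⊢
            grind
    · push Not at hmid
      by_cases hleft : ∃ x ∈ S, (x.2 : ℕ) = s
      · obtain ⟨x, hx, hxs⟩ := hleft
        exact hpend S subset_rfl hmid x hx hxs _
      · push Not at hleft
        refine hrung (s + 2) S (fun x hx => ?_) (by omega) k (by omega)
        have := hS x hx
        have := hmid x hx
        have := hleft x hx
        omega

theorem regEdgeIdeal_graphA_le (K : Type*) [Field K] (t : ℕ) :
    regEdgeIdeal K (graphA t) ≤ (t + 4) / 2 := by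
  have hmem : ∀ F : Finset (Fin (Fintype.card (Bool × Fin (t + 2)))),
      F ∈ indComplex (graphA t) ↔ F ∈ indOn (graphA t) (Fintype.equivFin _) Set.univ := by
    intro F
    simp [indComplex, indOn]
  refine regSR_le ?_ (fun W k hk => ?_) (by omega)
  · intro F F' hF' hF
    rw [Finset.mem_coe, hmem] at hF ⊢
    exact isLowerSet_indOn _ _ _ hF' hF
  · have h := exactAt_indOn_graphA (K := K) (Fintype.equivFin (Bool × Fin (t + 2))) ((t + 2) / 2) 0
      {x | Fintype.equivFin _ x ∈ W} (by simp)
      (fun x _ y _ hx hy hxy => by rw [graphA_adj] at hxy; omega) (by omega) k (by omega)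
    convert h using 1
    ext F
    simp only [Set.mem_ofPred_eq, hmem, indOn, Equiv.apply_symm_apply, Set.mem_univ]
    exact ⟨fun h => ⟨fun u hu => h.2 hu, h.1.2⟩, fun h => ⟨⟨fun _ _ => trivial, h.2⟩, h.1⟩⟩

/-- **Lemma 4.2(i), regularity part.**
For `t ≥ 1`, the edge ideal of the graph `A_t` satisfies
`reg(I(A_t)) ≤ (t+4)/2` if `t` is even and `reg(I(A_t)) ≤ (t+3)/2` if `t` is
odd. -/
theorem regularity_bound_graphA (K : Type*) [Field K] (t : ℕ) (ht : 1 ≤ t) :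
    (Even t → regEdgeIdeal K (graphA t) ≤ (t + 4) / 2) ∧
    (Odd t → regEdgeIdeal K (graphA t) ≤ (t + 3) / 2) := by
  have h := regEdgeIdeal_graphA_le K t
  refine ⟨fun _ => h, fun hodd => h.trans ?_⟩
  obtain ⟨m, rfl⟩ := hodd
  omega
end
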